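/- Let R be an associative unital ring, let n ≥ 1 and let y₁,…,y_{2n} ∈ R be such that, for every k = 1,…,n, both Euler continuants (y₁,…,y_{2k}) and (y_{2k},y_{2k−1},…,y₁) are invertible in R. Define y′₁ := y₁, y′_{2k} := y_{2k} for all k, and y′_{2k−1} := y_{2k−1} + (y₁,…,y_{2k−2})^{−1}·(y₁,…,y_{2k−3}) for 2 ≤ k ≤ n. Then for every ℓ = 1,…,n one has the factorisations (y₁,y₂,…,y_{2ℓ}) = (1 + y′₁y′₂)(1 + y′₃y′₄)⋯(1 + y′_{2ℓ−1}y′_{2ℓ}) and (y_{2ℓ},y_{2ℓ−1},…,y₁) = (1 + y′_{2ℓ}y′_{2ℓ−1})(1 + y′_{2ℓ−2}y′_{2ℓ−3})⋯(1 + y′₂y′₁). -/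

import Mathlib

/-- The Euler continuant `(y 1, …, y k)`, defined by the recursion
`( ) = 1`, `(x₁) = x₁`, `(x₁,…,x_k) = (x₁,…,x_{k−1})·x_k + (x₁,…,x_{k−2})`. -/
def cont {R : Type*} [Ring R] (y : ℕ → R) : ℕ → R
  | 0 => 1
  | 1 => y 1
  | k + 2 => cont y (k + 1) * y (k + 2) + cont y k

theorem cont_left {R : Type*} [Ring R] (x : ℕ → R) : ∀ k,
    cont x (k + 2) = x 1 * cont (fun i => x (i + 1)) (k + 1) + cont (fun i => x (i + 2)) k
  | 0 => by simp [cont]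
  | 1 => by simp [cont]; noncomm_ring
  | k + 2 => by
    have h1 := cont_left x (k + 1)
    have h0 := cont_left x k
    rw [cont.eq_3 x (k + 2), h1, h0, cont.eq_3 _ (k + 1), cont.eq_3 (fun i => x (i + 2)) k]
    noncomm_ring

def rcont {R : Type*} [Ring R] (y : ℕ → R) (k : ℕ) : R := cont (fun i => y (k + 1 - i)) k

theorem rcont_zero {R : Type*} [Ring R] (y : ℕ → R) : rcont y 0 = 1 := by simp [rcont, cont]

theorem rcont_one {R : Type*} [Ring R] (y : ℕ → R) : rcont y 1 = y 1 := by simp [rcont, cont]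

theorem rcont_rec {R : Type*} [Ring R] (y : ℕ → R) (k : ℕ) :
    rcont y (k + 2) = y (k + 2) * rcont y (k + 1) + rcont y k := by
  unfold rcont
  rw [cont_left]
  have e1 : ∀ i, k + 2 + 1 - (i + 1) = k + 1 + 1 - i := by intro i; omega
  simp only [e1, Nat.add_sub_add_right]
  rfl

theorem cont_comm {R : Type*} [Ring R] (y : ℕ → R) (k : ℕ) :
    cont y (k + 1) * rcont y k = cont y k * rcont y (k + 1) := by
  induction k with
  | zero => simp [rcont_zero, rcont_one, cont]
  | succ k ih =>
    rw [rcont_rec, cont, add_mul, mul_add, ← ih, mul_assoc]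

/-- Factorisation of the even Euler continuants into second Euler continuants: if all
`(y₁,…,y_{2k})` and `(y_{2k},…,y₁)` are invertible (with inverses `w k`, `v k`), and
`y′₁ = y₁`, `y′_{2k} = y_{2k}`, `y′_{2k−1} = y_{2k−1} + (y₁,…,y_{2k−2})⁻¹·(y₁,…,y_{2k−3})`
for `2 ≤ k ≤ n`, then for every `ℓ = 1,…,n`:
`(y₁,…,y_{2ℓ}) = (1 + y′₁y′₂)⋯(1 + y′_{2ℓ−1}y′_{2ℓ})` and
`(y_{2ℓ},…,y₁) = (1 + y′_{2ℓ}y′_{2ℓ−1})⋯(1 + y′₂y′₁)`. -/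
theorem continuant_factorisation {R : Type*} [Ring R] (n : ℕ) (hn : 1 ≤ n)
    (y : ℕ → R) (w v : ℕ → R)
    (hw : ∀ k, 1 ≤ k → k ≤ n →
      cont y (2 * k) * w k = 1 ∧ w k * cont y (2 * k) = 1)
    (hv : ∀ k, 1 ≤ k → k ≤ n →
      cont (fun i => y (2 * k + 1 - i)) (2 * k) * v k = 1 ∧
        v k * cont (fun i => y (2 * k + 1 - i)) (2 * k) = 1)
    (y' : ℕ → R)
    (hy'₁ : y' 1 = y 1)
    (hy'even : ∀ k, 1 ≤ k → k ≤ n → y' (2 * k) = y (2 * k))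
    (hy'odd : ∀ k, 2 ≤ k → k ≤ n →
      y' (2 * k - 1) = y (2 * k - 1) + w (k - 1) * cont y (2 * k - 3)) :
    ∀ ℓ, 1 ≤ ℓ → ℓ ≤ n →
      cont y (2 * ℓ) =
        ((List.range ℓ).map (fun m => 1 + y' (2 * m + 1) * y' (2 * m + 2))).prod ∧
      cont (fun i => y (2 * ℓ + 1 - i)) (2 * ℓ) =
        ((List.range ℓ).map (fun m => 1 + y' (2 * (ℓ - m)) * y' (2 * (ℓ - m) - 1))).prod := by
  intro ℓ hℓ
  change ℓ ≤ n → _ ∧ rcont y (2 * ℓ) = _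
  induction ℓ, hℓ using Nat.le_induction with
  | base =>
    intro _
    have h2 : y' 2 = y 2 := hy'even 1 le_rfl hn
    rw [show 2 * 1 = 0 + 2 from rfl, rcont_rec]
    simp [cont, rcont_zero, rcont_one, hy'₁, h2, add_comm]
  | succ l hl ih =>
    intro hln
    obtain ⟨ih1, ih2⟩ := ih (by omega)
    obtain ⟨j, rfl⟩ : ∃ j, l = j + 1 := ⟨l - 1, by omega⟩
    have he : y' (2 * j + 4) = y (2 * j + 4) := hy'even (j + 2) (by omega) hln
    have ho : y' (2 * j + 3) = y (2 * j + 3) + w (j + 1) * cont y (2 * j + 1) :=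
      hy'odd (j + 2) (by omega) hln
    obtain ⟨w1, w2⟩ := hw (j + 1) (by omega) (by omega)
    change cont y (2 * j + 2) * _ = 1 at w1
    change _ * cont y (2 * j + 2) = 1 at w2
    have hc : cont y (2 * j + 3) = cont y (2 * j + 2) * y' (2 * j + 3) := by
      rw [ho, mul_add, ← mul_assoc, w1, one_mul]; rfl
    have hd : rcont y (2 * j + 3) = y' (2 * j + 3) * rcont y (2 * j + 2) := by
      rw [ho, add_mul, mul_assoc, ← cont_comm y (2 * j + 1), ← mul_assoc, w2, one_mul]
      exact rcont_rec y (2 * j + 1)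
    constructor
    · rw [List.range_succ, List.map_append, List.prod_append, ← ih1]
      simp only [List.map_cons, List.map_nil, List.prod_cons, List.prod_nil, mul_one]
      change cont y (2 * j + 3) * y (2 * j + 4) + cont y (2 * j + 2) =
        cont y (2 * j + 2) * (1 + y' (2 * j + 3) * y' (2 * j + 4))
      rw [hc, he]; noncomm_ring
    · rw [List.range_succ_eq_map, List.map_cons, List.prod_cons, List.map_map]
      have hf : ((fun m => 1 + y' (2 * (j + 1 + 1 - m)) * y' (2 * (j + 1 + 1 - m) - 1)) ∘ Nat.succ)
          = (fun m => 1 + y' (2 * (j + 1 - m)) * y' (2 * (j + 1 - m) - 1)) := by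
        funext m
        simp only [Function.comp, Nat.succ_eq_add_one, Nat.add_sub_add_right]
      rw [hf, ← ih2]
      change rcont y (2 * j + 2 + 2) =
        (1 + y' (2 * j + 4) * y' (2 * j + 3)) * rcont y (2 * j + 2)
      rw [rcont_rec, hd, he]; noncomm_ring
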